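/- arXiv:2103.01615 — 3 statements merged into one kernel-verified Lean document; each statement's English description precedes it below -/
import Mathlib

section
/- Let SSE be the Slot Set Encoder with fixed slots S ∈ ℝ^{K×h} and fixed linear maps q, k, v. For any p ≥ 1, any matrices X₁ ∈ ℝ^{n₁×d}, …, X_p ∈ ℝ^{n_p×d}, and X ∈ ℝ^{n×d} (n = n₁+⋯+n_p) the vertical (row-wise) concatenation of X₁, …, X_p, the encoder satisfies SSE(X, S) = Σ_{t=1}^{p} SSE(X_t, S). In particular, with the aggregation function g = sum, mini-batch encoding of any partition of the rows of X yields exactly the encoding of the full set, i.e. the Slot Set Encoder is Mini-Batch Consistent. -/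
open Matrix

/-- The sigmoid function `σ(z) = 1/(1+e^{-z})`. -/
noncomputable def sigmoid (z : ℝ) : ℝ := 1 / (1 + Real.exp (-z))

/-- The Slot Set Encoder: given row-wise linear maps `k, v` (right multiplication by `Km, Vm`),
`q` (right multiplication by `Qm`), slots `S ∈ ℝ^{K×h}` and an input `X` whose rows (indexed by
an arbitrary finite index type `ι`) are the set elements, compute
`M = (1/√d̂)·k(X)·q(S)ᵀ`, `attn = σ(M)` entrywise, `W_{i,j} = attn_{i,j}/∑_l attn_{i,l}`,
and return `SSE(X,S) = Wᵀ·v(X) ∈ ℝ^{K×d̂}`. -/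
noncomputable def SSE {ι : Type} [Fintype ι] {d dh h K : ℕ}
    (Km : Matrix (Fin d) (Fin dh) ℝ) (Qm : Matrix (Fin h) (Fin dh) ℝ)
    (Vm : Matrix (Fin d) (Fin dh) ℝ)
    (X : Matrix ι (Fin d) ℝ) (S : Matrix (Fin K) (Fin h) ℝ) :
    Matrix (Fin K) (Fin dh) ℝ :=
  let M : Matrix ι (Fin K) ℝ := (1 / Real.sqrt dh) • (X * Km * (S * Qm)ᵀ)
  let attn : Matrix ι (Fin K) ℝ := Matrix.of fun i j => sigmoid (M i j)
  let W : Matrix ι (Fin K) ℝ := Matrix.of fun i j => attn i j / ∑ l, attn i l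
  Wᵀ * (X * Vm)

/-- **Mini-Batch Consistency of the Slot Set Encoder.** For any `p ≥ 1` and matrices
`X₁ ∈ ℝ^{n₁×d}, …, X_p ∈ ℝ^{n_p×d}`, letting `X` be their vertical (row-wise) concatenation
(the matrix whose rows are indexed by `Σ t, Fin (n t)`, with the rows of `X_t` in block `t`),
the Slot Set Encoder with fixed slots `S` and fixed linear maps `q, k, v` satisfies
`SSE(X, S) = ∑_{t=1}^{p} SSE(X_t, S)`: with aggregation `g = sum`, mini-batch encoding of any
partition of the rows of `X` yields exactly the encoding of the full set. -/
theorem sse_mini_batch_consistent {d dh h K : ℕ}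
    (Km : Matrix (Fin d) (Fin dh) ℝ) (Qm : Matrix (Fin h) (Fin dh) ℝ)
    (Vm : Matrix (Fin d) (Fin dh) ℝ) (S : Matrix (Fin K) (Fin h) ℝ)
    {p : ℕ} (hp : 1 ≤ p) (n : Fin p → ℕ)
    (Xs : ∀ t : Fin p, Matrix (Fin (n t)) (Fin d) ℝ)
    (X : Matrix ((t : Fin p) × Fin (n t)) (Fin d) ℝ)
    (hX : ∀ (t : Fin p) (i : Fin (n t)), X ⟨t, i⟩ = Xs t i) :
    SSE Km Qm Vm X S = ∑ t, SSE Km Qm Vm (Xs t) S := by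
  ext j a
  simp only [SSE, Matrix.sum_apply, Matrix.mul_apply, Matrix.transpose_apply, Matrix.of_apply,
    Matrix.smul_apply, Fintype.sum_sigma, hX]
end

section
/- The Hierarchical Slot Set Encoder is Mini-Batch Consistent: let SSE₁ be a Slot Set Encoder with fixed slots S ∈ ℝ^{K×h} and fixed linear maps q, k, v, and let h be any function on ℝ^{K×d̂} (e.g., a composition SSE_T ∘ ⋯ ∘ SSE₂ of further Slot Set Encoders applied to the K slot outputs). Then for any matrices X₁ ∈ ℝ^{n₁×d}, …, X_p ∈ ℝ^{n_p×d} whose vertical concatenation is X ∈ ℝ^{n×d}, h(Σ_{t=1}^{p} SSE₁(X_t, S)) = h(SSE₁(X, S)); i.e., aggregating the first-level mini-batch encodings by sum and then applying the remaining layers yields exactly the hierarchical encoding of the full set. -/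
open Matrix

/-- **The Hierarchical Slot Set Encoder is Mini-Batch Consistent.** Let `SSE₁` be a Slot Set
Encoder with fixed slots `S` and fixed linear maps `q, k, v`, and let `hfun` be any function
on `ℝ^{K×d̂}` (e.g. a composition `SSE_T ∘ ⋯ ∘ SSE₂` of further Slot Set Encoders). For
matrices `X₁ ∈ ℝ^{n₁×d}, …, X_p ∈ ℝ^{n_p×d}` whose vertical concatenation is `X` (the matrix
with rows indexed by `Σ t, Fin (n t)`, block `t` holding the rows of `X_t`),
`hfun (∑_t SSE₁(X_t, S)) = hfun (SSE₁(X, S))`: aggregating the first-level mini-batch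
encodings by sum and then applying the remaining layers yields exactly the hierarchical
encoding of the full set. -/
theorem hierarchical_sse_mini_batch_consistent {d dh h K : ℕ} {β : Type*}
    (Km : Matrix (Fin d) (Fin dh) ℝ) (Qm : Matrix (Fin h) (Fin dh) ℝ)
    (Vm : Matrix (Fin d) (Fin dh) ℝ) (S : Matrix (Fin K) (Fin h) ℝ)
    (hfun : Matrix (Fin K) (Fin dh) ℝ → β)
    {p : ℕ} (n : Fin p → ℕ)
    (Xs : ∀ t : Fin p, Matrix (Fin (n t)) (Fin d) ℝ)
    (X : Matrix ((t : Fin p) × Fin (n t)) (Fin d) ℝ)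
    (hX : ∀ (t : Fin p) (i : Fin (n t)), X ⟨t, i⟩ = Xs t i) :
    hfun (∑ t, SSE Km Qm Vm (Xs t) S) = hfun (SSE Km Qm Vm X S) := by
  congr 1
  ext a b
  simp [SSE, Matrix.sum_apply, Matrix.mul_apply, Fintype.sum_sigma, hX]
end

section
/- Softmax-weighted attention pooling violates Mini-Batch Consistency: define f on nonempty finite multisets X of real numbers by f(X) = Σ_{x ∈ X} (e^x / Σ_{y ∈ X} e^y) · x. Then there exist nonempty finite multisets A, A', B of real numbers with f(A) = f(A') but f(A ⊎ B) ≠ f(A' ⊎ B). Consequently, no aggregation function g : ℝ × ℝ → ℝ satisfies g(f(X₁), f(X₂)) = f(X₁ ⊎ X₂) for all nonempty finite multisets X₁, X₂; i.e., softmax-normalized pooling cannot be made Mini-Batch Consistent with any aggregation of the batch encodings alone. -/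
/-- Softmax-weighted attention pooling on a finite multiset `X` of reals:
`f(X) = ∑_{x ∈ X} (e^x / ∑_{y ∈ X} e^y) · x`. -/
noncomputable def softmaxPool (X : Multiset ℝ) : ℝ :=
  (X.map fun x => Real.exp x / (X.map Real.exp).sum * x).sum

theorem exists_softmaxPool_eq_and_add_ne :
    ∃ A A' B : Multiset ℝ, A ≠ 0 ∧ A' ≠ 0 ∧ B ≠ 0 ∧
      softmaxPool A = softmaxPool A' ∧ softmaxPool (A + B) ≠ softmaxPool (A' + B) := by
  refine ⟨{0}, {0, 0}, {1}, by simp, by simp, by simp, by simp [softmaxPool], ?_⟩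
  have h := Real.exp_pos 1
  simp only [softmaxPool, Multiset.insert_eq_cons, Multiset.map_add, Multiset.map_cons,
    Multiset.map_singleton, Multiset.sum_add, Multiset.sum_cons, Multiset.sum_singleton,
    Real.exp_zero, mul_zero, zero_add, mul_one, ne_eq]
  rw [div_eq_div_iff (by positivity) (by positivity)]
  intro heq
  linarith [mul_left_cancel₀ h.ne' heq]

/-- **Softmax-weighted attention pooling violates Mini-Batch Consistency.** There exist
nonempty finite multisets `A, A', B` of reals with `f(A) = f(A')` but
`f(A ⊎ B) ≠ f(A' ⊎ B)`; consequently no aggregation function `g : ℝ × ℝ → ℝ` satisfies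
`g(f(X₁), f(X₂)) = f(X₁ ⊎ X₂)` for all nonempty finite multisets `X₁, X₂`. -/
theorem softmaxPool_not_mini_batch_consistent :
    (∃ A A' B : Multiset ℝ, A ≠ 0 ∧ A' ≠ 0 ∧ B ≠ 0 ∧
      softmaxPool A = softmaxPool A' ∧ softmaxPool (A + B) ≠ softmaxPool (A' + B)) ∧
    ¬ ∃ g : ℝ → ℝ → ℝ, ∀ X₁ X₂ : Multiset ℝ, X₁ ≠ 0 → X₂ ≠ 0 →
        g (softmaxPool X₁) (softmaxPool X₂) = softmaxPool (X₁ + X₂) := by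
  refine ⟨exists_softmaxPool_eq_and_add_ne, ?_⟩
  rintro ⟨g, hg⟩
  obtain ⟨A, A', B, hA, hA', hB, heq, hne⟩ := exists_softmaxPool_eq_and_add_ne
  exact hne (by rw [← hg A B hA hB, ← hg A' B hA' hB, heq])
end
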